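/- Let Φ be a finite set of propositional variables and let P be a team property (a collection of pairs (M,T) with T a nonempty team of M). If P is invariant under full team bisimulation and P is k-local for some k∈ℕ, then P is invariant under k-bisimulation: whenever (M₁,T₁)∈P and (M₁,T₁) ~_k (M₂,T₂), also (M₂,T₂)∈P. -/

import Mathlib

/-- A Kripke model over propositional variables `Φ` with worlds `W`. -/
structure KripkeModel (Φ : Type) (W : Type) : Type where
  nonempty : Nonempty W
  R : W → W → Prop
  val : Φ → Set W

/-- ML formulas in negation normal form. -/
inductive MLFormula (Φ : Type) : Type
  | pos : Φ → MLFormula Φ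
  | neg : Φ → MLFormula Φ
  | and : MLFormula Φ → MLFormula Φ → MLFormula Φ
  | or  : MLFormula Φ → MLFormula Φ → MLFormula Φ
  | dia : MLFormula Φ → MLFormula Φ
  | box : MLFormula Φ → MLFormula Φ

variable {Φ W W₁ W₂ : Type}

/-- Team semantics for ML. -/
def MLTeamSat (M : KripkeModel Φ W) : MLFormula Φ → Set W → Prop
  | .pos p, T => T ⊆ M.val p
  | .neg p, T => T ∩ M.val p = ∅
  | .and φ ψ, T => MLTeamSat M φ T ∧ MLTeamSat M ψ T
  | .or φ ψ, T => ∃ T₁ T₂, T = T₁ ∪ T₂ ∧ MLTeamSat M φ T₁ ∧ MLTeamSat M ψ T₂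
  | .dia φ, T => ∃ T', MLTeamSat M φ T' ∧ (∀ w ∈ T, ∃ w' ∈ T', M.R w w') ∧
      (∀ w' ∈ T', ∃ w ∈ T, M.R w w')
  | .box φ, T => MLTeamSat M φ {w' | ∃ w ∈ T, M.R w w'}

/-- Standard single-world Kripke semantics for ML. -/
def MLWorldSat (M : KripkeModel Φ W) : MLFormula Φ → W → Prop
  | .pos p, w => w ∈ M.val p
  | .neg p, w => w ∉ M.val p
  | .and φ ψ, w => MLWorldSat M φ w ∧ MLWorldSat M ψ w
  | .or φ ψ, w => MLWorldSat M φ w ∨ MLWorldSat M ψ w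
  | .dia φ, w => ∃ w', M.R w w' ∧ MLWorldSat M φ w'
  | .box φ, w => ∀ w', M.R w w' → MLWorldSat M φ w'

/-- Modal depth of an ML formula. -/
def MLmd : MLFormula Φ → ℕ
  | .pos _ => 0
  | .neg _ => 0
  | .and φ ψ => max (MLmd φ) (MLmd ψ)
  | .or φ ψ => max (MLmd φ) (MLmd ψ)
  | .dia φ => MLmd φ + 1
  | .box φ => MLmd φ + 1

/-- `k`-bisimilarity of pointed Kripke models. -/
def kBisim (M₁ : KripkeModel Φ W₁) (M₂ : KripkeModel Φ W₂) : ℕ → W₁ → W₂ → Prop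
  | 0, w₁, w₂ => ∀ p, w₁ ∈ M₁.val p ↔ w₂ ∈ M₂.val p
  | k+1, w₁, w₂ => (∀ p, w₁ ∈ M₁.val p ↔ w₂ ∈ M₂.val p)
      ∧ (∀ w₁', M₁.R w₁ w₁' → ∃ w₂', M₂.R w₂ w₂' ∧ kBisim M₁ M₂ k w₁' w₂')
      ∧ (∀ w₂', M₂.R w₂ w₂' → ∃ w₁', M₁.R w₁ w₁' ∧ kBisim M₁ M₂ k w₁' w₂')

/-- `k`-bisimilarity of teams. -/
def teamKBisim (M₁ : KripkeModel Φ W₁) (M₂ : KripkeModel Φ W₂) (k : ℕ)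
    (T₁ : Set W₁) (T₂ : Set W₂) : Prop :=
  (∀ w₁ ∈ T₁, ∃ w₂ ∈ T₂, kBisim M₁ M₂ k w₁ w₂) ∧
  (∀ w₂ ∈ T₂, ∃ w₁ ∈ T₁, kBisim M₁ M₂ k w₁ w₂)

/-- Full team bisimilarity. -/
def teamBisim (M₁ : KripkeModel Φ W₁) (M₂ : KripkeModel Φ W₂)
    (T₁ : Set W₁) (T₂ : Set W₂) : Prop :=
  ∃ Z : W₁ → W₂ → Prop,
    (∀ w₁ w₂, Z w₁ w₂ →
      (∀ p, w₁ ∈ M₁.val p ↔ w₂ ∈ M₂.val p)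
      ∧ (∀ w₁', M₁.R w₁ w₁' → ∃ w₂', M₂.R w₂ w₂' ∧ Z w₁' w₂')
      ∧ (∀ w₂', M₂.R w₂ w₂' → ∃ w₁', M₁.R w₁ w₁' ∧ Z w₁' w₂')) ∧
    (∀ w₁ ∈ T₁, ∃ w₂ ∈ T₂, Z w₁ w₂) ∧
    (∀ w₂ ∈ T₂, ∃ w₁ ∈ T₁, Z w₁ w₂)

/-- MTL formulas: ML plus classical negation `∼`. -/
inductive MTLFormula (Φ : Type) : Type
  | pos : Φ → MTLFormula Φ
  | neg : Φ → MTLFormula Φ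
  | cneg : MTLFormula Φ → MTLFormula Φ
  | and : MTLFormula Φ → MTLFormula Φ → MTLFormula Φ
  | or  : MTLFormula Φ → MTLFormula Φ → MTLFormula Φ
  | dia : MTLFormula Φ → MTLFormula Φ
  | box : MTLFormula Φ → MTLFormula Φ

/-- Team semantics for MTL. -/
def MTLTeamSat (M : KripkeModel Φ W) : MTLFormula Φ → Set W → Prop
  | .pos p, T => T ⊆ M.val p
  | .neg p, T => T ∩ M.val p = ∅
  | .cneg φ, T => ¬ MTLTeamSat M φ T
  | .and φ ψ, T => MTLTeamSat M φ T ∧ MTLTeamSat M ψ T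
  | .or φ ψ, T => ∃ T₁ T₂, T = T₁ ∪ T₂ ∧ MTLTeamSat M φ T₁ ∧ MTLTeamSat M ψ T₂
  | .dia φ, T => ∃ T', MTLTeamSat M φ T' ∧ (∀ w ∈ T, ∃ w' ∈ T', M.R w w') ∧
      (∀ w' ∈ T', ∃ w ∈ T, M.R w w')
  | .box φ, T => MTLTeamSat M φ {w' | ∃ w ∈ T, M.R w w'}

/-- Modal depth of an MTL formula. -/
def MTLmd : MTLFormula Φ → ℕ
  | .pos _ => 0
  | .neg _ => 0
  | .cneg φ => MTLmd φ
  | .and φ ψ => max (MTLmd φ) (MTLmd ψ)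
  | .or φ ψ => max (MTLmd φ) (MTLmd ψ)
  | .dia φ => MTLmd φ + 1
  | .box φ => MTLmd φ + 1

/-- `reachLE M d w w'` holds iff there is an `R`-path of length at most `d`
from `w` to `w'`, i.e. the distance from `w` to `w'` is at most `d`. -/
def reachLE (M : KripkeModel Φ W) : ℕ → W → W → Prop
  | 0 => fun w w' => w = w'
  | d+1 => fun w w' => w = w' ∨ ∃ u, M.R w u ∧ reachLE M d u w'

/-- The `d`-neighborhood `N_d(T)` of a team `T`. -/
def nbhd (M : KripkeModel Φ W) (d : ℕ) (T : Set W) : Set W :=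
  {w' | ∃ w ∈ T, reachLE M d w w'}

theorem reachLE_self (M : KripkeModel Φ W) (d : ℕ) (w : W) : reachLE M d w w := by
  cases d with
  | zero => rfl
  | succ d => exact Or.inl rfl

theorem subset_nbhd (M : KripkeModel Φ W) (d : ℕ) (T : Set W) : T ⊆ nbhd M d T :=
  fun w hw => ⟨w, hw, reachLE_self M d w⟩

/-- The restriction `M ↾ S` of a Kripke model to a nonempty set `S` of worlds. -/
def restrict (M : KripkeModel Φ W) (S : Set W) (h : S.Nonempty) : KripkeModel Φ S where
  nonempty := h.to_subtype
  R := fun a b => M.R a b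
  val := fun p => {a | (a : W) ∈ M.val p}

/-- The layered unravelling of a Kripke model: worlds carry a level, which every step of the
accessibility relation increases by one. -/
def layered (M : KripkeModel Φ W) : KripkeModel Φ (W × ℕ) where
  nonempty := M.nonempty.map fun w => (w, 0)
  R := fun x y => M.R x.1 y.1 ∧ y.2 = x.2 + 1
  val := fun p => {x | x.1 ∈ M.val p}

/-- The copy of a team at level `0` of the layered unravelling. -/
def baseTeam (T : Set W) : Set (W × ℕ) :=
  {x | x.1 ∈ T ∧ x.2 = 0}

theorem baseTeam_nonempty {T : Set W} (hT : T.Nonempty) : (baseTeam T).Nonempty :=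
  hT.elim fun w hw => ⟨(w, 0), hw, rfl⟩

theorem teamBisim.symm {M₁ : KripkeModel Φ W₁} {M₂ : KripkeModel Φ W₂}
    {T₁ : Set W₁} {T₂ : Set W₂} (h : teamBisim M₁ M₂ T₁ T₂) : teamBisim M₂ M₁ T₂ T₁ := by
  obtain ⟨Z, hZ, h₁, h₂⟩ := h
  exact ⟨fun a b => Z b a,
    fun a b hab => ⟨fun p => ((hZ b a hab).1 p).symm, (hZ b a hab).2.2, (hZ b a hab).2.1⟩, h₂, h₁⟩

theorem teamBisim_layered (M : KripkeModel Φ W) (T : Set W) :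
    teamBisim M (layered M) T (baseTeam T) := by
  refine ⟨fun w x => x.1 = w, ?_, fun w hw => ⟨(w, 0), ⟨hw, rfl⟩, rfl⟩,
    fun x hx => ⟨x.1, hx.1, rfl⟩⟩
  rintro _ x rfl
  exact ⟨fun p => Iff.rfl, fun w hw => ⟨(w, x.2 + 1), ⟨hw, rfl⟩, rfl⟩,
    fun y hy => ⟨y.1, hy.1, rfl⟩⟩

theorem level_le_of_reachLE (M : KripkeModel Φ W) (d : ℕ) {x y : W × ℕ}
    (h : reachLE (layered M) d x y) : y.2 ≤ x.2 + d := by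
  induction d generalizing x with
  | zero =>
    obtain rfl : x = y := h
    exact le_rfl
  | succ d ih =>
    obtain rfl | ⟨u, hu, h⟩ := h
    · omega
    · have := ih h
      have := hu.2
      omega

theorem reachLE_of_level_lt (M : KripkeModel Φ W) (d : ℕ) {x y z : W × ℕ}
    (h : reachLE (layered M) d x y) (hlt : y.2 < x.2 + d) (hyz : (layered M).R y z) :
    reachLE (layered M) d x z := by
  induction d generalizing x with
  | zero =>
    obtain rfl : x = y := h
    omega
  | succ d ih =>
    obtain rfl | ⟨u, hu, h⟩ := h
    · exact Or.inr ⟨z, hyz, reachLE_self _ d z⟩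
    · exact Or.inr ⟨u, hu, ih h (by have := hu.2; omega)⟩

theorem level_le_of_mem_nbhd {M : KripkeModel Φ W} {k : ℕ} {T : Set W} {y : W × ℕ}
    (h : y ∈ nbhd (layered M) k (baseTeam T)) : y.2 ≤ k := by
  obtain ⟨x, hx, h⟩ := h
  have := level_le_of_reachLE M k h
  have := hx.2
  omega

theorem mem_nbhd_of_level_lt {M : KripkeModel Φ W} {k : ℕ} {T : Set W} {y z : W × ℕ}
    (h : y ∈ nbhd (layered M) k (baseTeam T)) (hlt : y.2 < k) (hyz : (layered M).R y z) :
    z ∈ nbhd (layered M) k (baseTeam T) := by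
  obtain ⟨x, hx, h⟩ := h
  exact ⟨x, hx, reachLE_of_level_lt M k h (by omega) hyz⟩

theorem kBisim.atoms {M₁ : KripkeModel Φ W₁} {M₂ : KripkeModel Φ W₂} {k : ℕ} {w₁ : W₁} {w₂ : W₂}
    (h : kBisim M₁ M₂ k w₁ w₂) (p : Φ) : w₁ ∈ M₁.val p ↔ w₂ ∈ M₂.val p := by
  cases k with
  | zero => exact h p
  | succ k => exact h.1 p

/-- On the `k`-neighborhoods of the base teams in the layered unravellings, `k`-bisimilarity of
teams becomes full bisimilarity: worlds at level `n` are related by `(k - n)`-bisimilarity. -/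
theorem teamKBisim.teamBisim_restrict_layered {M₁ : KripkeModel Φ W₁} {M₂ : KripkeModel Φ W₂}
    {k : ℕ} {T₁ : Set W₁} {T₂ : Set W₂} (h : teamKBisim M₁ M₂ k T₁ T₂)
    (h₁ : (nbhd (layered M₁) k (baseTeam T₁)).Nonempty)
    (h₂ : (nbhd (layered M₂) k (baseTeam T₂)).Nonempty) :
    teamBisim (restrict (layered M₁) _ h₁) (restrict (layered M₂) _ h₂)
      (Subtype.val ⁻¹' baseTeam T₁) (Subtype.val ⁻¹' baseTeam T₂) := by
  refine ⟨fun x y => ∃ m, x.1.2 + m = k ∧ y.1.2 + m = k ∧ kBisim M₁ M₂ m x.1.1 y.1.1, ?_, ?_, ?_⟩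
  · rintro x y ⟨m, hx, hy, hxy⟩
    refine ⟨hxy.atoms, ?_, ?_⟩
    · rintro x' ⟨hR, hl⟩
      have hle := level_le_of_mem_nbhd x'.2
      cases m with
      | zero => omega
      | succ m =>
        obtain ⟨w, hw, hb⟩ := hxy.2.1 _ hR
        exact ⟨⟨(w, y.1.2 + 1), mem_nbhd_of_level_lt y.2 (by omega) ⟨hw, rfl⟩⟩, ⟨hw, rfl⟩,
          m, by omega, by dsimp only; omega, hb⟩
    · rintro y' ⟨hR, hl⟩
      have hle := level_le_of_mem_nbhd y'.2
      cases m with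
      | zero => omega
      | succ m =>
        obtain ⟨w, hw, hb⟩ := hxy.2.2 _ hR
        exact ⟨⟨(w, x.1.2 + 1), mem_nbhd_of_level_lt x.2 (by omega) ⟨hw, rfl⟩⟩, ⟨hw, rfl⟩,
          m, by dsimp only; omega, by omega, hb⟩
  · rintro x ⟨hx, hx0⟩
    obtain ⟨w, hw, hb⟩ := h.1 _ hx
    exact ⟨⟨(w, 0), subset_nbhd _ _ _ ⟨hw, rfl⟩⟩, ⟨hw, rfl⟩, k, by omega, zero_add k, hb⟩
  · rintro y ⟨hy, hy0⟩
    obtain ⟨w, hw, hb⟩ := h.2 _ hy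
    exact ⟨⟨(w, 0), subset_nbhd _ _ _ ⟨hw, rfl⟩⟩, ⟨hw, rfl⟩, k, zero_add k, by omega, hb⟩

/-- A team property (on nonempty teams) over a finite set of propositional variables
that is invariant under full team bisimulation and `k`-local is invariant under
`k`-bisimulation. -/
theorem teamBisim_invariant_and_local_implies_kBisim_invariant [Finite Φ]
    (P : ∀ W : Type, KripkeModel Φ W → Set W → Prop) (k : ℕ)
    (hinv : ∀ (W₁ W₂ : Type) (M₁ : KripkeModel Φ W₁) (M₂ : KripkeModel Φ W₂)
      (T₁ : Set W₁) (T₂ : Set W₂), T₁.Nonempty → T₂.Nonempty →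
      P W₁ M₁ T₁ → teamBisim M₁ M₂ T₁ T₂ → P W₂ M₂ T₂)
    (hlocal : ∀ (W : Type) (M : KripkeModel Φ W) (T : Set W) (hT : T.Nonempty),
      P W M T ↔
        P (nbhd M k T)
          (restrict M (nbhd M k T) (hT.mono (subset_nbhd M k T)))
          (Subtype.val ⁻¹' T)) :
    ∀ (W₁ W₂ : Type) (M₁ : KripkeModel Φ W₁) (M₂ : KripkeModel Φ W₂)
      (T₁ : Set W₁) (T₂ : Set W₂), T₁.Nonempty → T₂.Nonempty →
      P W₁ M₁ T₁ → teamKBisim M₁ M₂ k T₁ T₂ → P W₂ M₂ T₂ := by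
  intro W₁ W₂ M₁ M₂ T₁ T₂ hT₁ hT₂ hP hk
  have hB₁ := baseTeam_nonempty hT₁
  have hB₂ := baseTeam_nonempty hT₂
  have hne {V : Type} {S N : Set V} (hS : S.Nonempty) (hSN : S ⊆ N) :
      ((Subtype.val : N → V) ⁻¹' S).Nonempty :=
    hS.elim fun x hx => ⟨⟨x, hSN hx⟩, hx⟩
  have hP₁ := (hlocal _ _ _ hB₁).1 (hinv _ _ _ _ _ _ hT₁ hB₁ hP (teamBisim_layered M₁ T₁))
  have hP₂ := hinv _ _ _ _ _ _ (hne hB₁ (subset_nbhd _ k _))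
    (hne hB₂ (subset_nbhd _ k _)) hP₁
    (hk.teamBisim_restrict_layered _ (hB₂.mono (subset_nbhd _ k _)))
  exact hinv _ _ _ _ _ _ hB₂ hT₂ ((hlocal _ _ _ hB₂).2 hP₂) (teamBisim_layered M₂ T₂).symm
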